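/- arXiv:2502.21279 — 2 statements merged into one kernel-verified Lean document; each statement's English description precedes it below -/
import Mathlib

section
/- Fix n ≥ 1, an input dimension d_x, and inner dimensions d_1, …, d_n with d_n's output mapped back to d_x. Let A and B be real diagonal d_x×d_x matrices, C_1 ∈ ℝ^{d_1×d_x}, C_l ∈ ℝ^{d_l×d_{l−1}} for l = 2,…,n (with d_n = d_x for the product B w_n to make sense as stated, or B ∈ ℝ^{d_x×d_n}), biases b_l ∈ ℝ^{d_l}, and for each l let σ_l : ℝ → ℝ be slope-restricted on [m_l, L_l] and applied entrywise. Define the residual map h : ℝ^{d_x} → ℝ^{d_x} by w_1(x) = σ_1(C_1 x + b_1), w_l(x) = σ_l(C_l w_{l−1}(x) + b_l) for l = 2,…,n, and h(x) = A x + B w_n(x). Let Λ_1, …, Λ_n be diagonal matrices with nonnegative diagonal entries, and let 𝓛 > 0. Form the symmetric block matrix M with block rows/columns indexed 0,1,…,n, with diagonal blocks M_{00} = AᵀA − 𝓛² I − 2 L_1 m_1 C_1ᵀ Λ_1 C_1, M_{ll} = −2 L_{l+1} m_{l+1} C_{l+1}ᵀ Λ_{l+1} C_{l+1} − 2 Λ_l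 for l = 1,…,n−1, M_{nn} = BᵀB − 2 Λ_n, off-diagonal blocks M_{l−1,l} = (L_l + m_l) C_lᵀ Λ_l for l = 1,…,n, corner blocks M_{0n} = AᵀB, and all other blocks zero. If M is negative semidefinite, then h is 𝓛-Lipschitz in the Euclidean norm: ‖h(x) − h(y)‖₂ ≤ 𝓛 ‖x − y‖₂ for all x, y ∈ ℝ^{d_x}. -/
open Matrix

/-- `σ : ℝ → ℝ` is slope-restricted on `[m, L]`: all difference quotients lie in `[m, L]`. -/
def SlopeRestricted (m L : ℝ) (σ : ℝ → ℝ) : Prop :=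
  ∀ x y : ℝ, x ≠ y → m ≤ (σ x - σ y) / (x - y) ∧ (σ x - σ y) / (x - y) ≤ L

/-- The inner layers of the residual block: `w 0 = σ₁(C₁ x + b₁)` and
`w (l+1) = σ_{l+2}(C_{l+2} (w l) + b_{l+2})`, where `C l`, `b l`, `σ l` here denote the
(l+1)-st layer's weight matrix, bias and activation, and `D l` is the l-th dimension
(`D 0` being the input dimension `d_x`). -/
noncomputable def resW (D : ℕ → ℕ)
    (C : ∀ l : ℕ, Matrix (Fin (D (l + 1))) (Fin (D l)) ℝ)
    (bias : ∀ l : ℕ, Fin (D (l + 1)) → ℝ) (σ : ℕ → ℝ → ℝ)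
    (x : Fin (D 0) → ℝ) : ∀ l : ℕ, Fin (D (l + 1)) → ℝ
  | 0 => fun i => σ 0 ((C 0 *ᵥ x + bias 0) i)
  | l + 1 => fun i => σ (l + 1) ((C (l + 1) *ᵥ resW D C bias σ x l + bias (l + 1)) i)

/-- The incremental sector bound of a slope-restricted function. -/
theorem SlopeRestricted.sector_nonneg {m L : ℝ} {σ : ℝ → ℝ} (hσ : SlopeRestricted m L σ)
    (a b : ℝ) :
    0 ≤ ((σ a - σ b) - m * (a - b)) * (L * (a - b) - (σ a - σ b)) := by
  rcases eq_or_ne a b with rfl | hab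
  · simp
  · obtain ⟨h₁, h₂⟩ := hσ a b hab
    have hne : a - b ≠ 0 := sub_ne_zero.mpr hab
    have hq : σ a - σ b = (σ a - σ b) / (a - b) * (a - b) := (div_mul_cancel₀ _ hne).symm
    generalize (σ a - σ b) / (a - b) = q at h₁ h₂ hq
    rw [hq]
    have h := mul_nonneg (mul_nonneg (sub_nonneg.mpr h₁) (sub_nonneg.mpr h₂)) (sq_nonneg (a - b))
    linarith

/-- The weighted quadratic constraint satisfied by one activation layer. -/
theorem SlopeRestricted.layer_nonneg {p q : ℕ} {m L : ℝ} {σ : ℝ → ℝ}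
    (hσ : SlopeRestricted m L σ) (C : Matrix (Fin q) (Fin p) ℝ) (b Λ : Fin q → ℝ)
    (hΛ : ∀ i, 0 ≤ Λ i) (u v z : Fin p → ℝ) (d : Fin q → ℝ) (hz : z = u - v)
    (hd : ∀ i, d i = σ ((C *ᵥ u + b) i) - σ ((C *ᵥ v + b) i)) :
    0 ≤ (-2 * L * m) * ((C *ᵥ z) ⬝ᵥ fun i => Λ i * (C *ᵥ z) i)
      + 2 * (L + m) * (z ⬝ᵥ (Cᵀ *ᵥ fun i => Λ i * d i))
      + (-2) * (d ⬝ᵥ fun i => Λ i * d i) := by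
  rw [dotProduct_mulVec, vecMul_transpose]
  simp only [dotProduct, Finset.mul_sum, ← Finset.sum_add_distrib]
  refine Finset.sum_nonneg fun i _ => ?_
  have hs := hσ.sector_nonneg ((C *ᵥ u + b) i) ((C *ᵥ v + b) i)
  have hdiff : (C *ᵥ u + b) i - (C *ᵥ v + b) i = (C *ᵥ z) i := by
    simp [hz, mulVec_sub]
  rw [hdiff, ← hd i] at hs
  linarith [mul_nonneg (hΛ i) hs]

theorem dotProduct_self_mulVec_add_mulVec {p q r : ℕ} (A : Matrix (Fin r) (Fin p) ℝ)
    (B : Matrix (Fin r) (Fin q) ℝ) (z : Fin p → ℝ) (w : Fin q → ℝ) :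
    (A *ᵥ z + B *ᵥ w) ⬝ᵥ (A *ᵥ z + B *ᵥ w) =
      z ⬝ᵥ ((Aᵀ * A) *ᵥ z) + w ⬝ᵥ ((Bᵀ * B) *ᵥ w) + 2 * (z ⬝ᵥ ((Aᵀ * B) *ᵥ w)) := by
  simp only [← mulVec_mulVec, dotProduct_mulVec _ Aᵀ, dotProduct_mulVec _ Bᵀ, vecMul_transpose,
    add_dotProduct, dotProduct_add]
  rw [dotProduct_comm (B *ᵥ w) (A *ᵥ z)]
  ring

/-- **Lipschitz certificate for a deep residual block via the LMI.**
With `n ≥ 1` inner layers of dimensions `D 1, …, D n` (input dimension `d_x = D 0`,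
and `D n = D 0` so the product `B wₙ` makes sense), diagonal `A, B`, weights `C`,
biases, activations `σ` slope-restricted on `[m, L]`, nonnegative diagonal multipliers
`Λ`, and `𝓛 > 0`: if the symmetric block matrix `M` (diagonal blocks
`AᵀA − 𝓛²I − 2L₁m₁C₁ᵀΛ₁C₁`, `−2L_{l+1}m_{l+1}C_{l+1}ᵀΛ_{l+1}C_{l+1} − 2Λ_l`,
`BᵀB − 2Λₙ`, off-diagonal blocks `(L_l+m_l)C_lᵀΛ_l`, corner `AᵀB`, zero elsewhere)
is negative semidefinite — expressed as its quadratic form being `≤ 0` on every block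
vector `(z₀, z₁, …, zₙ)` — then the residual map `h(x) = A x + B wₙ(x)` is
`𝓛`-Lipschitz in the Euclidean norm. -/
theorem residual_block_lmi_lipschitz
    (n : ℕ) (hn : 1 ≤ n) (D : ℕ → ℕ) (hD : D n = D 0)
    (A B : Matrix (Fin (D 0)) (Fin (D 0)) ℝ) (hA : A.IsDiag) (hB : B.IsDiag)
    (C : ∀ l : ℕ, Matrix (Fin (D (l + 1))) (Fin (D l)) ℝ)
    (bias : ∀ l : ℕ, Fin (D (l + 1)) → ℝ)
    (σ : ℕ → ℝ → ℝ) (m L : ℕ → ℝ) (hm : ∀ l, m l ≤ L l)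
    (hσ : ∀ l, SlopeRestricted (m l) (L l) (σ l))
    (Λ : ∀ l : ℕ, Fin (D (l + 1)) → ℝ) (hΛ : ∀ l i, 0 ≤ Λ l i)
    (𝓛 : ℝ) (h𝓛 : 0 < 𝓛)
    (hM : ∀ (z0 : Fin (D 0) → ℝ) (zw : ∀ l : ℕ, Fin (D (l + 1)) → ℝ),
      -- `prev l` is the block vector feeding layer `l+1`: `z0` for the first layer,
      -- `zw (l-1)` afterwards.
      let prev : ∀ l : ℕ, Fin (D l) → ℝ := fun l =>
        match l with
        | 0 => z0
        | k + 1 => zw k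
      -- the last block vector `zₙ`, reindexed over `Fin (D 0)` via `D n = D 0`.
      let zc : Fin (D 0) → ℝ := fun j =>
        zw (n - 1) (Fin.cast (show D 0 = D (n - 1 + 1) by
          rw [Nat.sub_add_cancel hn, hD]) j)
      z0 ⬝ᵥ ((Aᵀ * A) *ᵥ z0) - 𝓛 ^ 2 * (z0 ⬝ᵥ z0)
        + (∑ l ∈ Finset.range n,
            (-2 * L l * m l) *
              ((C l *ᵥ prev l) ⬝ᵥ fun i => Λ l i * (C l *ᵥ prev l) i))
        + (∑ l ∈ Finset.range n,
            2 * (L l + m l) * (prev l ⬝ᵥ ((C l)ᵀ *ᵥ fun i => Λ l i * zw l i)))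
        + (∑ l ∈ Finset.range n, (-2) * (zw l ⬝ᵥ fun i => Λ l i * zw l i))
        + zc ⬝ᵥ ((Bᵀ * B) *ᵥ zc) + 2 * (z0 ⬝ᵥ ((Aᵀ * B) *ᵥ zc)) ≤ 0) :
    ∀ x y : Fin (D 0) → ℝ,
      let h : (Fin (D 0) → ℝ) → Fin (D 0) → ℝ := fun x =>
        A *ᵥ x + B *ᵥ (fun j =>
          resW D C bias σ x (n - 1) (Fin.cast (show D 0 = D (n - 1 + 1) by
            rw [Nat.sub_add_cancel hn, hD]) j))
      Real.sqrt (∑ i, (h x i - h y i) ^ 2) ≤ 𝓛 * Real.sqrt (∑ i, (x i - y i) ^ 2) := by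
  intro x y h
  have key := hM (x - y) fun l => resW D C bias σ x l - resW D C bias σ y l
  extract_lets prev zc at key
  have layers : 0 ≤ ∑ l ∈ Finset.range n,
      ((-2 * L l * m l) * ((C l *ᵥ prev l) ⬝ᵥ fun i => Λ l i * (C l *ᵥ prev l) i)
        + 2 * (L l + m l) * (prev l ⬝ᵥ ((C l)ᵀ *ᵥ fun i =>
            Λ l i * (resW D C bias σ x l - resW D C bias σ y l) i))
        + (-2) * ((resW D C bias σ x l - resW D C bias σ y l) ⬝ᵥ fun i =>
            Λ l i * (resW D C bias σ x l - resW D C bias σ y l) i)) := by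
    refine Finset.sum_nonneg fun l _ => ?_
    cases l with
    | zero => exact (hσ 0).layer_nonneg (C 0) (bias 0) (Λ 0) (hΛ 0) x y _ _ rfl fun _ => rfl
    | succ k =>
      exact (hσ (k + 1)).layer_nonneg (C (k + 1)) (bias (k + 1)) (Λ (k + 1)) (hΛ (k + 1))
        (resW D C bias σ x k) (resW D C bias σ y k) _ _ rfl fun _ => rfl
  rw [Finset.sum_add_distrib, Finset.sum_add_distrib] at layers
  have hdiff : h x - h y = A *ᵥ (x - y) + B *ᵥ zc := by
    have hzc : zc = (fun j => resW D C bias σ x (n - 1) (Fin.cast (by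
          rw [Nat.sub_add_cancel hn, hD]) j)) - fun j =>
        resW D C bias σ y (n - 1) (Fin.cast (by rw [Nat.sub_add_cancel hn, hD]) j) := rfl
    rw [hzc, mulVec_sub, mulVec_sub]
    simp only [h]
    abel
  have hsq : ∀ a b : Fin (D 0) → ℝ, ∑ i, (a i - b i) ^ 2 = (a - b) ⬝ᵥ (a - b) := fun a b => by
    simp only [dotProduct, Pi.sub_apply, sq]
  have hle : ∑ i, (h x i - h y i) ^ 2 ≤ 𝓛 ^ 2 * ∑ i, (x i - y i) ^ 2 := by
    rw [hsq, hsq, hdiff, dotProduct_self_mulVec_add_mulVec]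
    linarith
  calc Real.sqrt (∑ i, (h x i - h y i) ^ 2)
      ≤ Real.sqrt (𝓛 ^ 2 * ∑ i, (x i - y i) ^ 2) := Real.sqrt_le_sqrt hle
    _ = 𝓛 * Real.sqrt (∑ i, (x i - y i) ^ 2) := by
      rw [Real.sqrt_mul (sq_nonneg 𝓛), Real.sqrt_sq h𝓛.le]
end

section
/- Let 𝓛 > 0, a, b ∈ ℝ, S ∈ ℝ with S ≠ 0, P ∈ ℝ with P ≤ 0, d ≥ 1, λ : Fin d → ℝ with λ_j > 0 for all j, and let C be a d × r real matrix whose rows satisfy Σ_z |C_{jz}| ≤ 2/|S| for every j. Suppose 𝓛² − a² − |a||b| ≥ 0, and fix a column index i such that |C_{ji}| ≤ (𝓛² − a² − |a||b|) |S| / ( d · λ_j · (|S|² + 4|P|) ) for every j. Then the first-block Gershgorin disc lies in the left half-plane: ( a² − 𝓛² − 2P Σ_j λ_j C_{ji}² ) + ( |a||b| + |S| Σ_j λ_j |C_{ji}| + 2|P| Σ_{z ≠ i} | Σ_j λ_j C_{ji} C_{jz} | ) ≤ 0. -/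
/-- The `i`-th absolute row sum of the weighted Gram matrix `Cᵀ diag(w) C` is at most the
corresponding weighted combination of the absolute row sums of `C`. -/
theorem sum_sq_add_sum_abs_le {m n : Type*} [Fintype m] [Fintype n] [DecidableEq n]
    (w : m → ℝ) (hw : ∀ j, 0 ≤ w j) (C : Matrix m n ℝ) (i : n) :
    (∑ j, w j * (C j i) ^ 2) + ∑ z ∈ Finset.univ.erase i, |∑ j, w j * C j i * C j z| ≤
      ∑ j, w j * |C j i| * ∑ z, |C j z| := by
  have habs : ∀ z, |∑ j, w j * C j i * C j z| ≤ ∑ j, w j * |C j i| * |C j z| := fun z =>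
    (Finset.abs_sum_le_sum_abs _ _).trans_eq <| Finset.sum_congr rfl fun j _ => by
      rw [abs_mul, abs_mul, abs_of_nonneg (hw j)]
  have hdiag : ∑ j, w j * (C j i) ^ 2 = ∑ j, w j * |C j i| * |C j i| :=
    Finset.sum_congr rfl fun j _ => by rw [mul_assoc, abs_mul_abs_self, sq]
  simp_rw [Finset.mul_sum]
  rw [Finset.sum_comm, ← Finset.add_sum_erase _ _ (Finset.mem_univ i), hdiag]
  gcongr with z
  exact habs z


/-- **First-block Gershgorin constraint.**
Let `𝓛 > 0`, `S ≠ 0`, `P ≤ 0`, `d ≥ 1`, `λ_j > 0`, and let `C` be a `d × r` matrix with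
row ℓ1-norms at most `2/|S|`. If `𝓛² - a² - |a||b| ≥ 0` and column `i` satisfies
`|C j i| ≤ (𝓛² - a² - |a||b|) |S| / (d * λ j * (|S|² + 4|P|))` for every `j`, then the
first-block Gershgorin disc lies in the left half-plane. -/
theorem first_block_gershgorin {d r : ℕ} (𝓛 a b S P : ℝ) (h𝓛 : 0 < 𝓛) (hS : S ≠ 0)
    (hP : P ≤ 0) (hd : 1 ≤ d) (lam : Fin d → ℝ) (hlam : ∀ j, 0 < lam j)
    (C : Matrix (Fin d) (Fin r) ℝ) (hrow : ∀ j, (∑ z, |C j z|) ≤ 2 / |S|)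
    (hab : 𝓛 ^ 2 - a ^ 2 - |a| * |b| ≥ 0) (i : Fin r)
    (hCi : ∀ j, |C j i| ≤ (𝓛 ^ 2 - a ^ 2 - |a| * |b|) * |S| /
      ((d : ℝ) * lam j * (|S| ^ 2 + 4 * |P|))) :
    (a ^ 2 - 𝓛 ^ 2 - 2 * P * ∑ j, lam j * (C j i) ^ 2) +
      (|a| * |b| + |S| * (∑ j, lam j * |C j i|) +
        2 * |P| * ∑ z ∈ Finset.univ.erase i, |∑ j, lam j * C j i * C j z|) ≤ 0 := by
  have hs : 0 < |S| := abs_pos.mpr hS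
  have hp : 0 ≤ |P| := abs_nonneg P
  have hd' : (0 : ℝ) < d := by exact_mod_cast hd
  have hcolumn := sum_sq_add_sum_abs_le lam (fun j => (hlam j).le) C i
  have hweighted : ∑ j, lam j * |C j i| * ∑ z, |C j z| ≤ ∑ j, lam j * |C j i| * (2 / |S|) :=
    Finset.sum_le_sum fun j _ =>
      mul_le_mul_of_nonneg_left (hrow j) (mul_nonneg (hlam j).le (abs_nonneg _))
  rw [← Finset.sum_mul] at hweighted
  have hentry : ∀ j ∈ Finset.univ, lam j * |C j i| ≤
      (𝓛 ^ 2 - a ^ 2 - |a| * |b|) * |S| / (d * (|S| ^ 2 + 4 * |P|)) := by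
    intro j _
    have hj := hlam j
    calc lam j * |C j i| ≤ lam j * ((𝓛 ^ 2 - a ^ 2 - |a| * |b|) * |S| /
          ((d : ℝ) * lam j * (|S| ^ 2 + 4 * |P|))) :=
          mul_le_mul_of_nonneg_left (hCi j) hj.le
      _ = _ := by field_simp
  have hsum := Finset.sum_le_card_nsmul _ _ _ hentry
  rw [Finset.card_univ, Fintype.card_fin, nsmul_eq_mul] at hsum
  set T := ∑ j, lam j * |C j i|
  have hT : T * (|S| + 4 * |P| / |S|) ≤ 𝓛 ^ 2 - a ^ 2 - |a| * |b| := by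
    calc T * (|S| + 4 * |P| / |S|) ≤ _ :=
          mul_le_mul_of_nonneg_right hsum (by positivity)
      _ = 𝓛 ^ 2 - a ^ 2 - |a| * |b| := by field_simp
  have hscaled := mul_le_mul_of_nonneg_left (hcolumn.trans hweighted)
    (mul_nonneg zero_le_two hp)
  have hcenter : -(2 * P * ∑ j, lam j * (C j i) ^ 2) =
      2 * |P| * ∑ j, lam j * (C j i) ^ 2 := by
    rw [abs_of_nonpos hP]
    ring
  have hexpand : T * (|S| + 4 * |P| / |S|) = |S| * T + 2 * |P| * (T * (2 / |S|)) := by ring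
  linarith
end
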